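/- Let X be a measurable space, D a probability measure on X, c : X → Bool a target concept, H a finite set of measurable hypotheses h : X → Bool, and ε ∈ (0,1). Then the probability, under the m-fold product measure D^m, of the event that there exists some h ∈ H with generalization error R(h,c) > ε which is nevertheless consistent with all m labeled examples (h(xᵢ) = c(xᵢ) for all i) is at most |H|·(1−ε)^m ≤ |H|·e^{−εm}. -/

import Mathlib

open MeasureTheory

/-- Generalization error `R(h,c) = D {x | h x ≠ c x}`. -/
noncomputable def genError {X : Type*} [MeasurableSpace X] (D : Measure X)
    (h c : X → Bool) : ENNReal :=
  D {x | h x ≠ c x}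

/-- If `h` errs against `c` with probability more than `ε`, then it is consistent with `c` on an
i.i.d. sample of size `m` with probability at most `(1 - ε) ^ m`. -/
theorem measure_pi_consistent_le {X : Type*} [MeasurableSpace X] (D : Measure X)
    [IsProbabilityMeasure D] {h c : X → Bool} (hh : Measurable h) (hc : Measurable c)
    {ε : ℝ} (hε : 0 ≤ ε) (hε1 : ε ≤ 1) (hbad : ENNReal.ofReal ε < genError D h c) (m : ℕ) :
    (Measure.pi fun _ : Fin m => D) {xs | ∀ i, h (xs i) = c (xs i)}
      ≤ ENNReal.ofReal ((1 - ε) ^ m) := by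
  have hpi : {xs : Fin m → X | ∀ i, h (xs i) = c (xs i)} =
      Set.univ.pi fun _ => {x | h x = c x} := by
    ext xs
    simp
  have hcompl : {x | h x = c x} = {x | h x ≠ c x}ᶜ := by
    ext x
    simp
  have hmeas : MeasurableSet {x | h x ≠ c x} := (measurableSet_eq_fun hh hc).compl
  have hD : D {x | h x = c x} ≤ ENNReal.ofReal (1 - ε) := by
    rw [hcompl, prob_compl_eq_one_sub hmeas,
      ENNReal.ofReal_sub 1 hε, ENNReal.ofReal_one]
    exact tsub_le_tsub_left hbad.le 1
  rw [hpi, Measure.pi_pi, Finset.prod_const, Finset.card_univ, Fintype.card_fin,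
    ENNReal.ofReal_pow (by linarith)]
  gcongr

/-- the probability under `D^m` that some `h ∈ H` with `R(h,c) > ε` is
consistent with all `m` labeled examples is at most `|H|·(1-ε)^m ≤ |H|·e^{-εm}`. -/
theorem union_bound_bad_consistent_hypotheses
    {X : Type*} [MeasurableSpace X] (D : Measure X) [IsProbabilityMeasure D]
    (c : X → Bool) (hc : Measurable c)
    (H : Finset (X → Bool)) (hHmeas : ∀ h ∈ H, Measurable h)
    (ε : ℝ) (hε : ε ∈ Set.Ioo (0 : ℝ) 1) (m : ℕ) :
    (Measure.pi fun _ : Fin m => D)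
        {xs : Fin m → X | ∃ h ∈ H,
          ENNReal.ofReal ε < genError D h c ∧ ∀ i : Fin m, h (xs i) = c (xs i)}
        ≤ ENNReal.ofReal ((H.card : ℝ) * (1 - ε) ^ m) ∧
      (H.card : ℝ) * (1 - ε) ^ m ≤ (H.card : ℝ) * Real.exp (-(ε * (m : ℝ))) := by
  constructor
  · have hsub : {xs : Fin m → X | ∃ h ∈ H,
          ENNReal.ofReal ε < genError D h c ∧ ∀ i : Fin m, h (xs i) = c (xs i)} =
        ⋃ h ∈ H, {xs : Fin m → X |
          ENNReal.ofReal ε < genError D h c ∧ ∀ i : Fin m, h (xs i) = c (xs i)} := by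
      ext xs
      simp only [Set.mem_ofPred_eq, Set.mem_iUnion, exists_prop]
    rw [hsub, ENNReal.ofReal_mul (Nat.cast_nonneg _), ENNReal.ofReal_natCast, ← nsmul_eq_mul]
    refine (measure_biUnion_finset_le H _).trans (Finset.sum_le_card_nsmul H _ _ fun h hh => ?_)
    by_cases hbad : ENNReal.ofReal ε < genError D h c
    · simpa only [hbad, true_and] using
        measure_pi_consistent_le D (hHmeas h hh) hc hε.1.le hε.2.le hbad m
    · simp [hbad]
  · have hexp : Real.exp (-(ε * (m : ℝ))) = Real.exp (-ε) ^ m := by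
      rw [← Real.exp_nat_mul]
      ring_nf
    rw [hexp]
    have h0 : 0 ≤ 1 - ε := by linarith [hε.2]
    gcongr
    exact Real.one_sub_le_exp_neg ε
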